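/- arXiv:0805.1650 — 2 statements merged into one kernel-verified Lean document; each statement's English description precedes it below -/
import Mathlib

section
/- Assume ω is total, i.e. the linear span of {ω(A,B) : A,B ∈ H} equals 𝐂. Then there exists c ∈ (0,1) such that c (‖A‖_H + sqrt(‖a‖_𝐂)) ≤ δ(e,(A,a)) ≤ c⁻¹ (‖A‖_H + sqrt(‖a‖_𝐂)) for all (A,a) ∈ 𝔤_CM. -/
open MeasureTheory
open scoped ENNReal

/-- The horizontal (Carnot–Carathéodory) distance on `𝔤_CM = H × 𝐂`: the infimum of the
horizontal lengths `∫₀¹ ‖w′(s)‖ ds` over horizontal `C¹` paths `(w, c)` joining `x` to `y`,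
with value `∞` if no horizontal path joins `x` to `y`. -/
noncomputable def dCC {H C : Type*} [NormedAddCommGroup H] [InnerProductSpace ℝ H]
    [NormedAddCommGroup C] [InnerProductSpace ℝ C]
    (ω : H →L[ℝ] H →L[ℝ] C) (x y : H × C) : ℝ≥0∞ :=
  ⨅ (w : ℝ → H) (c : ℝ → C) (_ : ContDiff ℝ 1 w) (_ : ContDiff ℝ 1 c)
    (_ : ∀ s ∈ Set.Icc (0:ℝ) 1, deriv c s = (2:ℝ)⁻¹ • ω (w s) (deriv w s))
    (_ : w 0 = x.1) (_ : c 0 = x.2) (_ : w 1 = y.1) (_ : c 1 = y.2),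
    ENNReal.ofReal (∫ s in (0:ℝ)..1, ‖deriv w s‖)

/-- `(A, a)` is the endpoint of a horizontal `C¹` path starting at the identity, of speed at
most `L`, which is stationary outside the time interval `(0, 1)`. -/
def HorizontallyReachable {H C : Type*} [NormedAddCommGroup H] [InnerProductSpace ℝ H]
    [NormedAddCommGroup C] [InnerProductSpace ℝ C]
    (ω : H →L[ℝ] H →L[ℝ] C) (L : ℝ) (A : H) (a : C) : Prop :=
  ∃ (w w' : ℝ → H) (c : ℝ → C), (∀ s, HasDerivAt w (w' s) s) ∧ Continuous w' ∧
    (∀ s, HasDerivAt c ((2:ℝ)⁻¹ • ω (w s) (w' s)) s) ∧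
    (∀ s ≤ 0, w s = 0 ∧ w' s = 0 ∧ c s = 0) ∧
    (∀ s, 1 ≤ s → w s = A ∧ w' s = 0 ∧ c s = a) ∧ ∀ s, ‖w' s‖ ≤ L

namespace HorizontallyReachable

variable {H C : Type*} [NormedAddCommGroup H] [InnerProductSpace ℝ H]
  [NormedAddCommGroup C] [InnerProductSpace ℝ C] {ω : H →L[ℝ] H →L[ℝ] C}

theorem nonneg {L : ℝ} {A : H} {a : C} (h : HorizontallyReachable ω L A a) : 0 ≤ L := by
  obtain ⟨w, w', c, -, -, -, -, -, hL⟩ := h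
  exact (norm_nonneg _).trans (hL 0)

theorem mono {L L' : ℝ} {A : H} {a : C} (h : HorizontallyReachable ω L A a) (hLL' : L ≤ L') :
    HorizontallyReachable ω L' A a := by
  obtain ⟨w, w', c, h1, h2, h3, h4, h5, h6⟩ := h
  exact ⟨w, w', c, h1, h2, h3, h4, h5, fun s => (h6 s).trans hLL'⟩

theorem zero : HorizontallyReachable ω 0 0 0 :=
  ⟨0, 0, 0, fun s => hasDerivAt_const s 0, continuous_const,
    fun s => by simp, by simp, by simp, by simp⟩

/-- Concatenation of horizontal paths realizes the group multiplication. -/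
theorem mul {L M : ℝ} {A B : H} {a b : C} (h : HorizontallyReachable ω L A a)
    (h' : HorizontallyReachable ω M B b) :
    HorizontallyReachable ω (2 * (L + M)) (A + B) (a + b + (2:ℝ)⁻¹ • ω A B) := by
  have hL := h.nonneg
  have hM := h'.nonneg
  obtain ⟨u, u', p, hu, hu', hp, hu0, hu1, huL⟩ := h
  obtain ⟨v, v', q, hv, hv', hq, hv0, hv1, hvM⟩ := h'
  have l1 : ∀ s : ℝ, HasDerivAt (fun s : ℝ => 2 * s) 2 s := fun s => by
    simpa using (hasDerivAt_id s).const_mul (2:ℝ)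
  have l2 : ∀ s : ℝ, HasDerivAt (fun s : ℝ => 2 * s - 1) 2 s := fun s => (l1 s).sub_const 1
  have hv2 : ∀ s, HasDerivAt (fun s => v (2 * s - 1)) ((2:ℝ) • v' (2 * s - 1)) s := fun s =>
    (hv (2 * s - 1)).scomp s (l2 s)
  refine ⟨fun s => u (2 * s) + v (2 * s - 1), fun s => (2:ℝ) • u' (2 * s) + (2:ℝ) • v' (2 * s - 1),
    fun s => p (2 * s) + q (2 * s - 1) + (2:ℝ)⁻¹ • ω A (v (2 * s - 1)),
    fun s => ((hu (2 * s)).scomp s (l1 s)).add (hv2 s), by fun_prop, fun s => ?_, fun s hs => ?_,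
    fun s hs => ?_, fun s => ?_⟩
  · have key := (((hp (2 * s)).scomp s (l1 s)).add ((hq (2 * s - 1)).scomp s (l2 s))).add
      (((ω A).hasFDerivAt.comp_hasDerivAt s (hv2 s)).const_smul (2:ℝ)⁻¹)
    refine key.congr_deriv ?_
    beta_reduce
    rcases le_total (2 * s) 1 with hs | hs
    · obtain ⟨e1, e2, -⟩ := hv0 (2 * s - 1) (by linarith)
      simp [e1, e2, smul_smul]
    · obtain ⟨e1, e2, -⟩ := hu1 (2 * s) hs
      simp only [e1, e2, map_add, map_smul, map_zero, smul_zero, zero_add, smul_add,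
        add_apply, smul_smul]
      rw [add_comm]
      norm_num
  · obtain ⟨e1, e2, e3⟩ := hu0 (2 * s) (by linarith)
    obtain ⟨f1, f2, f3⟩ := hv0 (2 * s - 1) (by linarith)
    simp [e1, e2, e3, f1, f2, f3]
  · obtain ⟨e1, e2, e3⟩ := hu1 (2 * s) (by linarith)
    obtain ⟨f1, f2, f3⟩ := hv1 (2 * s - 1) (by linarith)
    simp [e1, e2, e3, f1, f2, f3]
  · refine (norm_add_le _ _).trans ?_
    rw [norm_smul, norm_smul, Real.norm_of_nonneg zero_le_two]
    linarith [huL (2 * s), hvM (2 * s - 1)]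

theorem dCC_le {L : ℝ} {A : H} {a : C} (h : HorizontallyReachable ω L A a) :
    dCC ω ((0 : H), (0 : C)) (A, a) ≤ ENNReal.ofReal L := by
  obtain ⟨w, w', c, hw, hw', hc, h0, h1, hL⟩ := h
  have dw : deriv w = w' := funext fun s => (hw s).deriv
  have dc : deriv c = fun s => (2:ℝ)⁻¹ • ω (w s) (w' s) := funext fun s => (hc s).deriv
  have cw : Continuous w := continuous_iff_continuousAt.2 fun s => (hw s).continuousAt
  have hbound : ∫ s in (0:ℝ)..1, ‖deriv w s‖ ≤ L := by
    rw [dw]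
    calc ∫ s in (0:ℝ)..1, ‖w' s‖ ≤ ∫ _ in (0:ℝ)..1, L :=
          intervalIntegral.integral_mono_on zero_le_one
            (hw'.norm.intervalIntegrable _ _) intervalIntegrable_const fun s _ => hL s
      _ = L := by simp
  refine le_trans ?_ (ENNReal.ofReal_le_ofReal hbound)
  refine iInf₂_le_of_le w c (iInf₂_le_of_le ?_ ?_ (iInf₂_le_of_le ?_ (h0 0 le_rfl).1
    (iInf₂_le_of_le (h0 0 le_rfl).2.2 (h1 1 le_rfl).1 (iInf_le_of_le (h1 1 le_rfl).2.2 le_rfl))))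
  · exact contDiff_one_iff_deriv.2 ⟨fun s => (hw s).differentiableAt, dw ▸ hw'⟩
  · refine contDiff_one_iff_deriv.2 ⟨fun s => (hc s).differentiableAt, ?_⟩
    rw [dc]
    fun_prop
  · intro s _
    rw [dw, dc]

theorem apply_self_eq_zero (hskew : ∀ A B : H, ω A B = - ω B A) (A : H) : ω A A = 0 := by
  have h := hskew A A
  rw [eq_neg_iff_add_eq_zero, ← two_smul ℝ] at h
  simpa using h

/-- Reparametrized straight lines are horizontal, with speed controlled by the endpoint. -/
theorem exists_line (hskew : ∀ A B : H, ω A B = - ω B A) :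
    ∃ K : ℝ, 0 ≤ K ∧ ∀ A : H, HorizontallyReachable ω (K * ‖A‖) A 0 := by
  have hself := apply_self_eq_zero hskew
  have hdiff : ContDiff ℝ 1 Real.smoothTransition := Real.smoothTransition.contDiff
  have hd := contDiff_one_iff_deriv.1 hdiff
  have d0 : ∀ s ≤ (0:ℝ), deriv Real.smoothTransition s = 0 := fun s hs =>
    IsLocalMin.deriv_eq_zero (Filter.Eventually.of_forall fun t => by
      rw [Real.smoothTransition.zero_of_nonpos hs]; exact Real.smoothTransition.nonneg t)
  have d1 : ∀ s, (1:ℝ) ≤ s → deriv Real.smoothTransition s = 0 := fun s hs =>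
    IsLocalMax.deriv_eq_zero (Filter.Eventually.of_forall fun t => by
      rw [Real.smoothTransition.one_of_one_le hs]; exact Real.smoothTransition.le_one t)
  obtain ⟨K, hK⟩ := (isCompact_Icc (a := (0:ℝ)) (b := 1)).exists_bound_of_continuousOn
    hd.2.continuousOn
  have hK0 : 0 ≤ K := (norm_nonneg _).trans (hK 0 (by simp))
  have hbd : ∀ s, ‖deriv Real.smoothTransition s‖ ≤ K := fun s => by
    rcases le_total s 0 with h | h
    · simpa [d0 s h] using hK0
    rcases le_total 1 s with h' | h'
    · simpa [d1 s h'] using hK0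
    exact hK s ⟨h, h'⟩
  refine ⟨K, hK0, fun A => ⟨fun s => Real.smoothTransition s • A,
    fun s => deriv Real.smoothTransition s • A, fun _ => 0,
    fun s => (hd.1 s).hasDerivAt.smul_const A, hd.2.smul continuous_const, fun s => ?_,
    fun s hs => ?_, fun s hs => ?_, fun s => ?_⟩⟩
  · simpa [hself] using hasDerivAt_const s (0 : C)
  · simp [Real.smoothTransition.zero_of_nonpos hs, d0 s hs]
  · simp [Real.smoothTransition.one_of_one_le hs, d1 s hs]
  · rw [norm_smul]
    exact mul_le_mul_of_nonneg_right (hbd s) (norm_nonneg A)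

/-- The commutator loop of two lines reaches `(0, ω A B)`. -/
theorem exists_loop (hskew : ∀ A B : H, ω A B = - ω B A) :
    ∃ K : ℝ, 0 ≤ K ∧ ∀ A B : H, HorizontallyReachable ω (K * (‖A‖ + ‖B‖)) 0 (ω A B) := by
  have hself := apply_self_eq_zero hskew
  obtain ⟨K, hK0, hK⟩ := exists_line hskew
  refine ⟨8 * K, by positivity, fun A B => ?_⟩
  have key := ((hK A).mul (hK B)).mul ((hK (-A)).mul (hK (-B)))
  have e1 : A + B + (-A + -B) = 0 := by abel
  have e2 : -A + -B = -(A + B) := by abel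
  have e3 : ω A B = 0 + 0 + (2:ℝ)⁻¹ • ω A B + (0 + 0 + (2:ℝ)⁻¹ • ω (-A) (-B)) +
      (2:ℝ)⁻¹ • ω (A + B) (-A + -B) := by
    rw [e2, map_neg (ω (A + B)), hself]
    simp only [map_neg, neg_apply, neg_neg, zero_add, neg_zero, smul_zero,
      add_zero, ← add_smul]
    norm_num
  rw [e1, ← e3, norm_neg, norm_neg] at key
  exact key.mono (by ring_nf; rfl)

/-- Dilated loops reach `(0, t • ω A B)` with speed of order `√|t|`. -/
theorem exists_dilated_loop (hskew : ∀ A B : H, ω A B = - ω B A) (A B : H) :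
    ∃ K : ℝ, 0 ≤ K ∧ ∀ t : ℝ, HorizontallyReachable ω (K * √|t|) 0 (t • ω A B) := by
  obtain ⟨K, hK0, hK⟩ := exists_loop hskew
  have hpos : ∀ t : ℝ, 0 ≤ t → ∀ D : H,
      HorizontallyReachable ω (K * (‖A‖ + ‖D‖) * √t) 0 (t • ω A D) := fun t ht D => by
    have key := hK (√t • A) (√t • D)
    rw [map_smul, map_smul, smul_apply, smul_smul, Real.mul_self_sqrt ht,
      norm_smul, norm_smul, Real.norm_of_nonneg (Real.sqrt_nonneg t)] at key
    exact key.mono (by ring_nf; rfl)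
  refine ⟨K * (‖A‖ + ‖B‖), by positivity, fun t => ?_⟩
  rcases le_total 0 t with ht | ht
  · simpa [abs_of_nonneg ht] using hpos t ht B
  · simpa [abs_of_nonpos ht] using hpos (-t) (neg_nonneg.2 ht) (-B)

/-- If `ω` is total, every central element `(0, a)` is reached with speed of order `√‖a‖`. -/
theorem exists_vertical [FiniteDimensional ℝ C] (hskew : ∀ A B : H, ω A B = - ω B A)
    (htotal : Submodule.span ℝ {c : C | ∃ A B : H, ω A B = c} = ⊤) :
    ∃ K : ℝ, 0 ≤ K ∧ ∀ a : C, HorizontallyReachable ω (K * √‖a‖) 0 a := by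
  classical
  let b := Module.Basis.ofSpan htotal.ge
  have hb : ∀ i, ∃ A B : H, ω A B = b i := fun i =>
    Module.Basis.ofSpan_subset htotal.ge (Set.mem_range_self i)
  have := Module.Finite.finite_basis b
  have := Fintype.ofFinite
    ((linearIndepOn_empty ℝ id).extend (Set.empty_subset {c : C | ∃ A B : H, ω A B = c}))
  have key : ∀ S : Finset _, ∃ K : ℝ, 0 ≤ K ∧
      ∀ a : C, HorizontallyReachable ω (K * √‖a‖) 0 (∑ i ∈ S, b.repr a i • b i) := by
    intro S
    induction S using Finset.induction_on with
    | empty => exact ⟨0, le_rfl, fun a => by simpa using zero⟩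
    | insert i S hi ih =>
      obtain ⟨K, hK0, hK⟩ := ih
      obtain ⟨A, B, hAB⟩ := hb i
      obtain ⟨M, hM0, hM⟩ := exists_dilated_loop hskew A B
      let f := (b.coord i).toContinuousLinearMap
      refine ⟨2 * (M * √‖f‖ + K), by positivity, fun a => ?_⟩
      have h := (hM (b.repr a i)).mul (hK a)
      rw [hAB] at h
      rw [Finset.sum_insert hi]
      simp only [map_zero, smul_zero, add_zero] at h
      refine h.mono ?_
      have hle : √|b.repr a i| ≤ √‖f‖ * √‖a‖ := by
        rw [← Real.sqrt_mul (norm_nonneg f)]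
        exact Real.sqrt_le_sqrt (f.le_opNorm a)
      nlinarith [mul_le_mul_of_nonneg_left hle hM0]
  obtain ⟨K, hK0, hK⟩ := key Finset.univ
  exact ⟨K, hK0, fun a => by simpa [b.sum_repr] using hK a⟩

end HorizontallyReachable

/-- The displacement of a `C¹` path on `[0, 1]` whose speed is dominated by a constant multiple
of a continuous function `g` is bounded by that multiple of the integral of `g`. -/
theorem norm_le_mul_integral_of_norm_deriv_le {E : Type*} [NormedAddCommGroup E]
    [NormedSpace ℝ E] {f : ℝ → E} {g : ℝ → ℝ} {K : ℝ} (hf : Differentiable ℝ f)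
    (hf0 : f 0 = 0) (hg : Continuous g)
    (hfg : ∀ s ∈ Set.Icc (0:ℝ) 1, ‖deriv f s‖ ≤ K * g s) {s : ℝ} (hs : s ∈ Set.Icc (0:ℝ) 1) :
    ‖f s‖ ≤ K * ∫ t in (0:ℝ)..s, g t :=
  image_norm_le_of_norm_deriv_right_le_deriv_boundary (f' := deriv f)
    (B := fun s => K * ∫ t in (0:ℝ)..s, g t) (B' := fun s => K * g s)
    hf.continuous.continuousOn (fun x _ => (hf x).hasDerivAt.hasDerivWithinAt) (by simp [hf0])
    (fun x => (hg.integral_hasStrictDerivAt 0 x).hasDerivAt.const_mul K)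
    (fun x hx => hfg x ⟨hx.1, hx.2.le⟩) hs

theorem norm_endpoint_le_of_horizontal {H C : Type*} [NormedAddCommGroup H]
    [InnerProductSpace ℝ H] [NormedAddCommGroup C] [InnerProductSpace ℝ C]
    {ω : H →L[ℝ] H →L[ℝ] C} {w : ℝ → H} {c : ℝ → C} (hw : ContDiff ℝ 1 w) (hc : ContDiff ℝ 1 c)
    (hwc : ∀ s ∈ Set.Icc (0:ℝ) 1, deriv c s = (2:ℝ)⁻¹ • ω (w s) (deriv w s))
    (hw0 : w 0 = 0) (hc0 : c 0 = 0) :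
    ‖w 1‖ + √‖c 1‖ ≤ (1 + √‖ω‖) * ∫ s in (0:ℝ)..1, ‖deriv w s‖ := by
  have hdw := contDiff_one_iff_deriv.1 hw
  have hdc := contDiff_one_iff_deriv.1 hc
  have hint : ∀ x y, IntervalIntegrable (fun t => ‖deriv w t‖) volume x y := fun x y =>
    hdw.2.norm.intervalIntegrable x y
  set L := ∫ s in (0:ℝ)..1, ‖deriv w s‖ with hL
  have hL0 : 0 ≤ L := intervalIntegral.integral_nonneg zero_le_one fun s _ => norm_nonneg _
  have hwL : ∀ s ∈ Set.Icc (0:ℝ) 1, ‖w s‖ ≤ L := fun s hs => by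
    have h := norm_le_mul_integral_of_norm_deriv_le (K := 1) hdw.1 hw0 hdw.2.norm
      (fun s _ => by simp) hs
    rw [one_mul] at h
    exact h.trans (intervalIntegral.integral_mono_interval le_rfl hs.1 hs.2
      (Filter.Eventually.of_forall fun _ => norm_nonneg _) (hint 0 1))
  have hcL : ‖c 1‖ ≤ ‖ω‖ * L * L := by
    refine norm_le_mul_integral_of_norm_deriv_le hdc.1 hc0 hdw.2.norm (fun s hs => ?_)
      (Set.right_mem_Icc.2 zero_le_one)
    have h1 := ω.le_opNorm₂ (w s) (deriv w s)
    have h2 : ‖ω‖ * ‖w s‖ * ‖deriv w s‖ ≤ ‖ω‖ * L * ‖deriv w s‖ := by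
      gcongr
      exact hwL s hs
    rw [hwc s hs, norm_smul, Real.norm_of_nonneg (by norm_num)]
    linarith [norm_nonneg (ω (w s) (deriv w s))]
  have hsqrt : √‖c 1‖ ≤ √‖ω‖ * L := by
    calc √‖c 1‖ ≤ √(‖ω‖ * (L * L)) := Real.sqrt_le_sqrt (by rwa [← mul_assoc])
      _ = √‖ω‖ * L := by rw [Real.sqrt_mul (norm_nonneg ω), Real.sqrt_mul_self hL0]
  linarith [hwL 1 (Set.right_mem_Icc.2 zero_le_one)]

/-- If `ω` is total then there exists `c ∈ (0,1)` with
`c (‖A‖_H + √‖a‖_𝐂) ≤ δ(e,(A,a)) ≤ c⁻¹ (‖A‖_H + √‖a‖_𝐂)` for all `(A,a) ∈ 𝔤_CM`. -/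
theorem horizontal_dist_comparable_of_total
    {H C : Type*} [NormedAddCommGroup H] [InnerProductSpace ℝ H]
    [TopologicalSpace.SeparableSpace H]
    [NormedAddCommGroup C] [InnerProductSpace ℝ C] [FiniteDimensional ℝ C]
    (ω : H →L[ℝ] H →L[ℝ] C)
    (hskew : ∀ A B : H, ω A B = - ω B A)
    (htotal : Submodule.span ℝ {c : C | ∃ A B : H, ω A B = c} = ⊤) :
    ∃ c : ℝ, c ∈ Set.Ioo (0:ℝ) 1 ∧ ∀ (A : H) (a : C),
      ENNReal.ofReal (c * (‖A‖ + Real.sqrt ‖a‖)) ≤ dCC ω ((0 : H), (0 : C)) (A, a) ∧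
      dCC ω ((0 : H), (0 : C)) (A, a) ≤ ENNReal.ofReal (c⁻¹ * (‖A‖ + Real.sqrt ‖a‖)) := by
  obtain ⟨K, hK0, hK⟩ := HorizontallyReachable.exists_line hskew
  obtain ⟨M, hM0, hM⟩ := HorizontallyReachable.exists_vertical hskew htotal
  have hω := Real.sqrt_nonneg ‖ω‖
  set N : ℝ := 2 + √‖ω‖ + 2 * K + 2 * M with hN
  have hN1 : 1 < N := by linarith
  have hNpos : 0 < N := by linarith
  refine ⟨N⁻¹, ⟨inv_pos.2 hNpos, inv_lt_one_of_one_lt₀ hN1⟩, fun A a => ⟨?_, ?_⟩⟩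
  · refine le_iInf₂ fun w c => le_iInf₂ fun hw hc => le_iInf₂ fun hwc hw0 => le_iInf₂
      fun hc0 hw1 => le_iInf fun hc1 => ENNReal.ofReal_le_ofReal ?_
    have h := norm_endpoint_le_of_horizontal hw hc hwc hw0 hc0
    rw [hw1, hc1] at h
    rw [inv_mul_le_iff₀ hNpos]
    refine h.trans (mul_le_mul_of_nonneg_right (by linarith) ?_)
    exact intervalIntegral.integral_nonneg zero_le_one fun s _ => norm_nonneg _
  · have h := (hM a).mul (hK A)
    simp only [map_zero, zero_apply, smul_zero, add_zero, zero_add] at h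
    rw [inv_inv]
    refine (h.mono ?_).dCC_le
    have h1 : 2 * M * √‖a‖ ≤ N * √‖a‖ :=
      mul_le_mul_of_nonneg_right (by linarith) (Real.sqrt_nonneg _)
    have h2 : 2 * K * ‖A‖ ≤ N * ‖A‖ :=
      mul_le_mul_of_nonneg_right (by linarith) (norm_nonneg A)
    linarith
end

section
/- If q_ν(f,f) ≤ q_μ(f,f) for all f ∈ W*, then for every nonnegative, nondecreasing C¹ function g : [0,∞) → [0,∞): ∫_W g(‖w‖_W) dν(w) ≤ ∫_W g(‖w‖_W) dμ(w). -/
open MeasureTheory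

section

open Set ProbabilityTheory
open scoped Matrix MatrixOrder ENNReal Pointwise RealInnerProductSpace Convolution

/-- The one-dimensional Brunn–Minkowski inequality for compact sets. -/
theorem Real.volume_add_le_volume_add_of_isCompact {K L : Set ℝ} (hK : IsCompact K)
    (hL : IsCompact L) (hK₀ : K.Nonempty) (hL₀ : L.Nonempty) :
    volume K + volume L ≤ volume (K + L) := by
  obtain ⟨a, haK, ha⟩ := hK.exists_isGreatest hK₀
  obtain ⟨b, hbL, hb⟩ := hL.exists_isLeast hL₀
  have h₁ : volume K ≤ volume ((K + L) ∩ Iic (b + a)) := by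
    rw [← measure_vadd volume b K]
    refine measure_mono ?_
    rintro _ ⟨x, hx, rfl⟩
    refine ⟨⟨x, hx, b, hbL, add_comm _ _⟩, ?_⟩
    have := ha hx
    simpa using this
  have h₂ : volume L ≤ volume ((K + L) \ Iic (b + a)) := by
    rw [← measure_vadd volume a L, ← measure_sdiff_null (s := a +ᵥ L) (t := {b + a}) (by simp)]
    refine measure_mono ?_
    rintro _ ⟨⟨y, hy, rfl⟩, hne⟩
    refine ⟨⟨a, haK, y, hy, rfl⟩, ?_⟩
    have h := hb hy
    simp only [vadd_eq_add, mem_singleton_iff, mem_Iic, not_le] at hne ⊢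
    exact lt_of_le_of_ne (by linarith) (Ne.symm hne)
  calc volume K + volume L ≤ _ := add_le_add h₁ h₂
    _ = volume (K + L) := measure_inter_add_sdiff _ measurableSet_Iic

/-- The one-dimensional Brunn–Minkowski inequality for midpoints of measurable sets. -/
theorem Real.volume_add_volume_le_two_mul {S T U : Set ℝ} (hS : MeasurableSet S)
    (hT : MeasurableSet T) (hS₀ : S.Nonempty) (hT₀ : T.Nonempty)
    (hU : ∀ x ∈ S, ∀ y ∈ T, (2⁻¹ : ℝ) • (x + y) ∈ U) :
    volume S + volume T ≤ 2 * volume U := by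
  obtain ⟨s, hs⟩ := hS₀
  obtain ⟨t, ht⟩ := hT₀
  simp_rw [hS.measure_eq_iSup_isCompact, hT.measure_eq_iSup_isCompact, iSup_and']
  refine ENNReal.biSup_add_biSup_le' ⟨∅, empty_subset _, isCompact_empty⟩
    ⟨∅, empty_subset _, isCompact_empty⟩ fun K hK L hL ↦ ?_
  calc volume K + volume L ≤ volume (insert s K) + volume (insert t L) := by
        gcongr <;> exact subset_insert _ _
    _ ≤ volume (insert s K + insert t L) :=
        volume_add_le_volume_add_of_isCompact (hK.2.insert s) (hL.2.insert t)
          (insert_nonempty _ _) (insert_nonempty _ _)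
    _ ≤ volume ((2 : ℝ) • U) := by
        refine measure_mono ?_
        rintro _ ⟨x, hx, y, hy, rfl⟩
        exact ⟨_, hU x (insert_subset hs hK.1 hx) y (insert_subset ht hL.1 hy), by simp⟩
    _ = 2 * volume U := by simp [Measure.addHaar_smul]

/-- The property that a measure satisfies the Prékopa–Leindler inequality
with weight `1 / 2`. -/
def SatisfiesPrekopaLeindler {E : Type*} [AddCommGroup E] [Module ℝ E] [MeasurableSpace E]
    (μ : Measure E) : Prop :=
  ∀ f g h : E → ℝ≥0∞, Measurable f → Measurable g → Measurable h →
    (∀ x y, f x * g y ≤ h ((2⁻¹ : ℝ) • (x + y)) ^ 2) →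
    (∫⁻ x, f x ∂μ) * (∫⁻ x, g x ∂μ) ≤ (∫⁻ x, h x ∂μ) ^ 2

theorem lintegral_add_le_two_mul_lintegral_of_mul_le_sq {f g h : ℝ → ℝ} (hf : Measurable f)
    (hg : Measurable g) (hh : Measurable h) (hf₀ : 0 ≤ f) (hg₀ : 0 ≤ g) (hh₀ : 0 ≤ h)
    (hf₁ : IsLUB (range f) 1) (hg₁ : IsLUB (range g) 1)
    (hfg : ∀ x y, f x * g y ≤ h ((2⁻¹ : ℝ) • (x + y)) ^ 2) :
    (∫⁻ x, ENNReal.ofReal (f x)) + ∫⁻ x, ENNReal.ofReal (g x) ≤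
      2 * ∫⁻ x, ENNReal.ofReal (h x) := by
  have hmeas (u : ℝ → ℝ) : Measurable fun t : ℝ ↦ volume {x | t < u x} :=
    Antitone.measurable fun s t hst ↦ measure_mono fun x hx ↦ hst.trans_lt hx
  rw [lintegral_eq_lintegral_meas_lt _ (ae_of_all _ hf₀) hf.aemeasurable,
    lintegral_eq_lintegral_meas_lt _ (ae_of_all _ hg₀) hg.aemeasurable,
    lintegral_eq_lintegral_meas_lt _ (ae_of_all _ hh₀) hh.aemeasurable,
    ← lintegral_add_left (hmeas f), ← lintegral_const_mul _ (hmeas h)]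
  refine setLIntegral_mono ((hmeas h).const_mul _) fun t (ht : 0 < t) ↦ ?_
  rcases lt_or_ge t 1 with ht₁ | ht₁
  · refine Real.volume_add_volume_le_two_mul (measurableSet_lt measurable_const hf)
      (measurableSet_lt measurable_const hg) ?_ ?_ fun x hx y hy ↦ ?_
    · obtain ⟨_, ⟨x, rfl⟩, hx⟩ := (lt_isLUB_iff hf₁).1 ht₁
      exact ⟨x, hx⟩
    · obtain ⟨_, ⟨x, rfl⟩, hx⟩ := (lt_isLUB_iff hg₁).1 ht₁
      exact ⟨x, hx⟩
    · simp only [mem_ofPred_eq] at hx hy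
      refine lt_of_pow_lt_pow_left₀ 2 (hh₀ _) (lt_of_lt_of_le ?_ (hfg x y))
      rw [sq]
      exact mul_lt_mul'' hx hy ht.le ht.le
  · have h₁ : {x | t < f x} = ∅ :=
      eq_empty_of_forall_notMem fun x hx ↦ (ht₁.trans_lt hx).not_ge (hf₁.1 ⟨x, rfl⟩)
    have h₂ : {x | t < g x} = ∅ :=
      eq_empty_of_forall_notMem fun x hx ↦ (ht₁.trans_lt hx).not_ge (hg₁.1 ⟨x, rfl⟩)
    simp [h₁, h₂]

theorem ENNReal.mul_le_sq_of_add_le_two_mul {a b c : ℝ≥0∞} (h : a + b ≤ 2 * c) :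
    a * b ≤ c ^ 2 := by
  rcases eq_or_ne c ∞ with rfl | hc
  · simp
  have hab : a + b ≠ ∞ := ne_top_of_le_ne_top (by finiteness) h
  lift c to NNReal using hc
  lift a to NNReal using (ENNReal.add_ne_top.1 hab).1
  lift b to NNReal using (ENNReal.add_ne_top.1 hab).2
  norm_cast at h ⊢
  rw [← NNReal.coe_le_coe] at h ⊢
  push_cast at h ⊢
  nlinarith [sq_nonneg ((a : ℝ) - b), a.2, b.2, c.2, pow_le_pow_left₀ (by positivity) h 2]

theorem lintegral_mul_lintegral_le_sq_of_bddAbove {f g h : ℝ → ℝ} (hf : Measurable f)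
    (hg : Measurable g) (hh : Measurable h) (hf₀ : 0 ≤ f) (hg₀ : 0 ≤ g) (hh₀ : 0 ≤ h)
    (hf₁ : BddAbove (range f)) (hg₁ : BddAbove (range g))
    (hfg : ∀ x y, f x * g y ≤ h ((2⁻¹ : ℝ) • (x + y)) ^ 2) :
    (∫⁻ x, ENNReal.ofReal (f x)) * ∫⁻ x, ENNReal.ofReal (g x) ≤
      (∫⁻ x, ENNReal.ofReal (h x)) ^ 2 := by
  have hlub {u : ℝ → ℝ} (hu : BddAbove (range u)) {c : ℝ} (hc : 0 < c) (h : ⨆ x, u x = c) :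
      IsLUB (range fun x ↦ u x / c) 1 := by
    have hlub := isLUB_ciSup hu
    rw [h] at hlub
    refine ⟨?_, fun b hb ↦ ?_⟩
    · rintro _ ⟨x, rfl⟩
      exact (div_le_one hc).2 (hlub.1 ⟨x, rfl⟩)
    · rw [← le_mul_iff_one_le_left hc]
      refine hlub.2 ?_
      rintro _ ⟨x, rfl⟩
      exact (div_le_iff₀ hc).1 (hb ⟨x, rfl⟩)
  rcases (Real.iSup_nonneg hf₀).eq_or_lt with hM | hM
  · have : f = 0 := funext fun x ↦ le_antisymm ((le_ciSup hf₁ x).trans hM.ge) (hf₀ x)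
    simp [this]
  rcases (Real.iSup_nonneg hg₀).eq_or_lt with hN | hN
  · have : g = 0 := funext fun x ↦ le_antisymm ((le_ciSup hg₁ x).trans hN.ge) (hg₀ x)
    simp [this]
  set M := ⨆ x, f x
  set N := ⨆ x, g x
  have hMN : 0 < √(M * N) := by positivity
  have hscale {u : ℝ → ℝ} (hu : Measurable u) {c : ℝ} (hc : 0 < c) :
      ∫⁻ x, ENNReal.ofReal (u x) = ENNReal.ofReal c * ∫⁻ x, ENNReal.ofReal (u x / c) := by
    rw [← lintegral_const_mul _ (by fun_prop)]
    refine lintegral_congr fun x ↦ ?_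
    rw [← ENNReal.ofReal_mul hc.le, mul_div_cancel₀ _ hc.ne']
  have key := ENNReal.mul_le_sq_of_add_le_two_mul <|
    lintegral_add_le_two_mul_lintegral_of_mul_le_sq (f := fun x ↦ f x / M) (g := fun x ↦ g x / N)
    (h := fun x ↦ h x / √(M * N)) (by fun_prop) (by fun_prop) (by fun_prop)
    (fun x ↦ div_nonneg (hf₀ x) hM.le) (fun x ↦ div_nonneg (hg₀ x) hN.le)
    (fun x ↦ div_nonneg (hh₀ x) hMN.le) (hlub hf₁ hM rfl) (hlub hg₁ hN rfl) fun x y ↦ by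
      rw [div_mul_div_comm, div_pow, Real.sq_sqrt (by positivity)]
      gcongr
      exact hfg x y
  rw [hscale hf hM, hscale hg hN, hscale hh hMN, mul_mul_mul_comm, mul_pow,
    ← ENNReal.ofReal_pow hMN.le, Real.sq_sqrt (by positivity), ENNReal.ofReal_mul hM.le]
  gcongr

theorem lintegral_eq_iSup_lintegral_min {α : Type*} [MeasurableSpace α] (μ : Measure α)
    {f : α → ℝ≥0∞} (hf : Measurable f) :
    ∫⁻ x, f x ∂μ = ⨆ n : ℕ, ∫⁻ x, min (f x) n ∂μ := by
  rw [← lintegral_iSup (f := fun (n : ℕ) x ↦ min (f x) n) (fun n ↦ by fun_prop)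
    (fun m n hmn x ↦ min_le_min_left _ (by exact_mod_cast hmn))]
  refine lintegral_congr fun x ↦ ?_
  rw [← inf_iSup_eq, ENNReal.iSup_natCast, inf_top_eq]

/-- The one-dimensional **Prékopa–Leindler inequality**. -/
theorem satisfiesPrekopaLeindler_volume_real : SatisfiesPrekopaLeindler (volume : Measure ℝ) := by
  intro f g h hf hg hh hfg
  have key (n : ℕ) : (∫⁻ x, min (f x) n) * (∫⁻ x, min (g x) n) ≤ (∫⁻ x, h x) ^ 2 := by
    have hfin (u : ℝ → ℝ≥0∞) (x : ℝ) : min (u x) n ≠ ∞ := by simp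
    have hbdd (u : ℝ → ℝ≥0∞) : BddAbove (range fun x ↦ (min (u x) n).toReal) := by
      refine ⟨n, ?_⟩
      rintro _ ⟨x, rfl⟩
      exact ENNReal.toReal_le_of_le_ofReal (by positivity) (by simp)
    have := lintegral_mul_lintegral_le_sq_of_bddAbove (f := fun x ↦ (min (f x) n).toReal)
      (g := fun x ↦ (min (g x) n).toReal) (h := fun x ↦ (min (h x) n).toReal)
      (by fun_prop) (by fun_prop) (by fun_prop) (fun _ ↦ ENNReal.toReal_nonneg)
      (fun _ ↦ ENNReal.toReal_nonneg) (fun _ ↦ ENNReal.toReal_nonneg) (hbdd f) (hbdd g)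
      fun x y ↦ by
        rw [← ENNReal.toReal_mul, ← ENNReal.toReal_pow]
        refine ENNReal.toReal_mono (ENNReal.pow_ne_top (hfin _ _)) ?_
        rcases le_total (h ((2⁻¹ : ℝ) • (x + y))) n with hn | hn
        · rw [min_eq_left hn]
          exact (mul_le_mul' (min_le_left _ _) (min_le_left _ _)).trans (hfg x y)
        · rw [min_eq_right hn, sq]
          exact mul_le_mul' (min_le_right _ _) (min_le_right _ _)
    simp_rw [ENNReal.ofReal_toReal (hfin _ _)] at this
    refine this.trans ?_
    gcongr
    exact min_le_left _ _
  rw [lintegral_eq_iSup_lintegral_min _ hf, lintegral_eq_iSup_lintegral_min _ hg]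
  simp_rw [ENNReal.iSup_mul, ENNReal.mul_iSup]
  refine iSup_le fun m ↦ iSup_le fun n ↦ le_trans ?_ (key (max m n))
  gcongr <;> simp

theorem SatisfiesPrekopaLeindler.withDensity {E : Type*} [AddCommGroup E] [Module ℝ E]
    [MeasurableSpace E] {μ : Measure E} (hμ : SatisfiesPrekopaLeindler μ) {p : E → ℝ≥0∞}
    (hp : Measurable p) (hpp : ∀ x y, p x * p y ≤ p ((2⁻¹ : ℝ) • (x + y)) ^ 2) :
    SatisfiesPrekopaLeindler (μ.withDensity p) := by
  intro f g h hf hg hh hfg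
  simp_rw [lintegral_withDensity_eq_lintegral_mul μ hp hf,
    lintegral_withDensity_eq_lintegral_mul μ hp hg, lintegral_withDensity_eq_lintegral_mul μ hp hh]
  refine hμ _ _ _ (hp.mul hf) (hp.mul hg) (hp.mul hh) fun x y ↦ ?_
  simp only [Pi.mul_apply]
  rw [mul_mul_mul_comm, mul_pow]
  exact mul_le_mul' (hpp x y) (hfg x y)

theorem SatisfiesPrekopaLeindler.prod {E F : Type*} [AddCommGroup E] [Module ℝ E]
    [MeasurableSpace E] [AddCommGroup F] [Module ℝ F] [MeasurableSpace F] {μ : Measure E}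
    {ν : Measure F} [SFinite ν] (hμ : SatisfiesPrekopaLeindler μ)
    (hν : SatisfiesPrekopaLeindler ν) : SatisfiesPrekopaLeindler (μ.prod ν) := by
  intro f g h hf hg hh hfg
  rw [lintegral_prod _ hf.aemeasurable, lintegral_prod _ hg.aemeasurable,
    lintegral_prod _ hh.aemeasurable]
  refine hμ _ _ _ hf.lintegral_prod_right' hg.lintegral_prod_right' hh.lintegral_prod_right'
    fun x y ↦ ?_
  exact hν _ _ _ (by fun_prop) (by fun_prop) (by fun_prop) fun u v ↦ hfg (x, u) (y, v)

theorem SatisfiesPrekopaLeindler.map {E F : Type*} [AddCommGroup E] [Module ℝ E]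
    [MeasurableSpace E] [AddCommGroup F] [Module ℝ F] [MeasurableSpace F] {μ : Measure E}
    (hμ : SatisfiesPrekopaLeindler μ) (L : E →ₗ[ℝ] F) (hL : Measurable L) :
    SatisfiesPrekopaLeindler (μ.map L) := by
  intro f g h hf hg hh hfg
  rw [lintegral_map hf hL, lintegral_map hg hL, lintegral_map hh hL]
  refine hμ _ _ _ (hf.comp hL) (hg.comp hL) (hh.comp hL) fun x y ↦ ?_
  simpa using hfg (L x) (L y)

theorem satisfiesPrekopaLeindler_dirac {E : Type*} [AddCommGroup E] [Module ℝ E]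
    [MeasurableSpace E] (a : E) : SatisfiesPrekopaLeindler (Measure.dirac a) := by
  intro f g h hf hg hh hfg
  rw [lintegral_dirac' _ hf, lintegral_dirac' _ hg, lintegral_dirac' _ hh]
  simpa [← two_smul ℝ a, smul_smul] using hfg a a

theorem satisfiesPrekopaLeindler_pi {n : ℕ} (μ : Fin n → Measure ℝ) [∀ i, SigmaFinite (μ i)]
    (hμ : ∀ i, SatisfiesPrekopaLeindler (μ i)) : SatisfiesPrekopaLeindler (Measure.pi μ) := by
  induction n with
  | zero =>
    rw [Measure.pi_of_empty μ 0]
    exact satisfiesPrekopaLeindler_dirac _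
  | succ n ih =>
    have hmp := (measurePreserving_piFinSuccAbove μ 0).symm
    have hcons : ⇑(MeasurableEquiv.piFinSuccAbove (fun _ : Fin (n + 1) ↦ ℝ) 0).symm =
        Fin.consLinearEquiv ℝ fun _ : Fin (n + 1) ↦ ℝ := by
      ext x : 1
      exact Fin.insertNth_zero' x.1 x.2
    rw [← hmp.map_eq, hcons]
    exact ((hμ 0).prod (ih _ fun j ↦ hμ _)).map
      (Fin.consLinearEquiv ℝ fun _ : Fin (n + 1) ↦ ℝ).toLinearMap
      (hcons ▸ hmp.measurable)

theorem satisfiesPrekopaLeindler_gaussianReal :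
    SatisfiesPrekopaLeindler (gaussianReal 0 1) := by
  rw [gaussianReal_of_var_ne_zero _ one_ne_zero]
  refine satisfiesPrekopaLeindler_volume_real.withDensity (measurable_gaussianPDF 0 1)
    fun x y ↦ ?_
  rw [gaussianPDF, gaussianPDF, gaussianPDF, ← ENNReal.ofReal_mul (gaussianPDFReal_nonneg _ _ _),
    ← ENNReal.ofReal_pow (gaussianPDFReal_nonneg _ _ _)]
  refine ENNReal.ofReal_le_ofReal ?_
  simp only [gaussianPDFReal]
  rw [mul_mul_mul_comm, mul_pow, ← Real.exp_add, ← Real.exp_nat_mul, ← sq]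
  gcongr
  simp only [sub_zero, NNReal.coe_one, smul_eq_mul]
  push_cast
  nlinarith [sq_nonneg (x - y)]

theorem satisfiesPrekopaLeindler_multivariateGaussian {ι : Type*} [Fintype ι] [DecidableEq ι]
    (S : Matrix ι ι ℝ) : SatisfiesPrekopaLeindler (multivariateGaussian 0 S) := by
  have hstd : SatisfiesPrekopaLeindler (stdGaussian (EuclideanSpace ℝ ι)) := by
    rw [stdGaussian]
    have := (satisfiesPrekopaLeindler_pi (fun _ ↦ gaussianReal 0 1) fun _ ↦
      satisfiesPrekopaLeindler_gaussianReal).map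
      (Fintype.linearCombination ℝ (stdOrthonormalBasis ℝ (EuclideanSpace ℝ ι)))
      (by
        change Measurable fun x : Fin _ → ℝ ↦ ∑ i, x i • _
        fun_prop)
    exact this
  rw [multivariateGaussian]
  simp only [zero_add]
  exact hstd.map (Matrix.toEuclideanCLM (𝕜 := ℝ) (CFC.sqrt S)).toLinearMap (by fun_prop)

/-- **Anderson's inequality**. -/
theorem SatisfiesPrekopaLeindler.measure_add_mem_le {E : Type*} [AddCommGroup E] [Module ℝ E]
    [MeasurableSpace E] [MeasurableAdd E] [MeasurableNeg E] {μ : Measure E}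
    (hμ : SatisfiesPrekopaLeindler μ)
    (hneg : μ.map (fun x ↦ -x) = μ) {C : Set E} (hC : MeasurableSet C) (hconv : Convex ℝ C)
    (hsymm : ∀ x ∈ C, -x ∈ C) (a : E) : μ {x | a + x ∈ C} ≤ μ C := by
  have hm (b : E) : MeasurableSet {x | b + x ∈ C} := measurable_const_add b hC
  have h₁ : μ {x | -a + x ∈ C} = μ {x | a + x ∈ C} := by
    conv_lhs => rw [← hneg]
    rw [Measure.map_apply measurable_neg (hm _)]
    congr 1
    ext x
    simp only [mem_preimage, mem_ofPred_eq]
    exact ⟨fun h ↦ by simpa [add_comm] using hsymm _ h, fun h ↦ by rw [← neg_add]; exact hsymm _ h⟩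
  have key := hμ (indicator {x | a + x ∈ C} 1) (indicator {x | -a + x ∈ C} 1) (indicator C 1)
    (measurable_one.indicator (hm _)) (measurable_one.indicator (hm _))
    (measurable_one.indicator hC) fun x y ↦ by
      by_cases hx : a + x ∈ C
      · by_cases hy : -a + y ∈ C
        · have : (2⁻¹ : ℝ) • (x + y) ∈ C := by
            convert hconv hx hy (a := 2⁻¹) (b := 2⁻¹) (by norm_num) (by norm_num)
              (by norm_num) using 1
            module
          simp [-smul_add, this, hx, hy]
        · simp [hy]
      · simp [hx]
  rw [lintegral_indicator_one (hm _), lintegral_indicator_one (hm _), lintegral_indicator_one hC,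
    h₁, ← sq] at key
  exact (ENNReal.pow_le_pow_left_iff two_ne_zero).1 key

theorem map_neg_multivariateGaussian_zero {ι : Type*} [Fintype ι] [DecidableEq ι]
    {S : Matrix ι ι ℝ} (hS : S.PosSemidef) :
    (multivariateGaussian 0 S).map (fun x ↦ -x) = multivariateGaussian 0 S := by
  have : IsFiniteMeasure ((multivariateGaussian 0 S).map fun x ↦ -x) :=
    Measure.isFiniteMeasure_map _ _
  refine Measure.ext_of_charFun (funext fun t ↦ ?_)
  have h : (fun x : EuclideanSpace ℝ ι ↦ -x) = fun x ↦ (-1 : ℝ) • x := by ext; simp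
  rw [h, charFun_map_smul, charFun_multivariateGaussian hS, charFun_multivariateGaussian hS]
  simp [Matrix.mulVec_neg]

theorem multivariateGaussian_conv_multivariateGaussian {ι : Type*} [Fintype ι] [DecidableEq ι]
    {S T : Matrix ι ι ℝ} (hS : S.PosSemidef) (hT : T.PosSemidef) :
    multivariateGaussian 0 S ∗ multivariateGaussian 0 T = multivariateGaussian 0 (S + T) := by
  refine Measure.ext_of_charFun (funext fun t ↦ ?_)
  rw [charFun_conv, charFun_multivariateGaussian hS, charFun_multivariateGaussian hT,
    charFun_multivariateGaussian (hS.add hT), ← Complex.exp_add]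
  simp only [Matrix.add_mulVec, dotProduct_add, inner_zero_right]
  push_cast
  ring_nf

/-- A symmetric convex set has smaller measure under a centered Gaussian measure with larger
covariance matrix. -/
theorem multivariateGaussian_apply_le {ι : Type*} [Fintype ι] [DecidableEq ι]
    {S T : Matrix ι ι ℝ} (hS : S.PosSemidef) (hST : (T - S).PosSemidef)
    {C : Set (EuclideanSpace ℝ ι)} (hC : MeasurableSet C) (hconv : Convex ℝ C)
    (hsymm : ∀ x ∈ C, -x ∈ C) :
    multivariateGaussian 0 T C ≤ multivariateGaussian 0 S C := by
  have hT : multivariateGaussian 0 (T - S) ∗ multivariateGaussian 0 S =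
      multivariateGaussian 0 T := by
    rw [multivariateGaussian_conv_multivariateGaussian hST hS, sub_add_cancel]
  rw [← hT, ← lintegral_indicator_one hC, Measure.lintegral_conv (measurable_one.indicator hC)]
  calc ∫⁻ x, ∫⁻ y, C.indicator 1 (x + y) ∂multivariateGaussian 0 S ∂multivariateGaussian 0 (T - S)
      = ∫⁻ x, multivariateGaussian 0 S {y | x + y ∈ C} ∂multivariateGaussian 0 (T - S) := by
        refine lintegral_congr fun x ↦ ?_
        have hx : MeasurableSet {y | x + y ∈ C} := measurable_const_add x hC
        rw [← lintegral_indicator_one hx]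
        rfl
    _ ≤ ∫⁻ _, multivariateGaussian 0 S C ∂multivariateGaussian 0 (T - S) :=
        lintegral_mono fun x ↦
          (satisfiesPrekopaLeindler_multivariateGaussian S).measure_add_mem_le
            (map_neg_multivariateGaussian_zero hS) hC hconv hsymm x
    _ = multivariateGaussian 0 S C := by simp

theorem LinearMap.BilinForm.dotProduct_mulVec_of_apply {V ι : Type*} [AddCommGroup V] [Module ℝ V]
    [Fintype ι] (B : LinearMap.BilinForm ℝ V) (f : ι → V) (x : ι → ℝ) :
    x ⬝ᵥ Matrix.of (fun i j ↦ B (f i) (f j)) *ᵥ x = B (∑ i, x i • f i) (∑ i, x i • f i) := by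
  simp only [dotProduct, Matrix.mulVec, Matrix.of_apply, map_sum, map_smul, LinearMap.sum_apply,
    LinearMap.smul_apply, smul_eq_mul, Finset.mul_sum]
  rw [Finset.sum_comm]
  exact Finset.sum_congr rfl fun i _ ↦ Finset.sum_congr rfl fun j _ ↦ by ring

theorem LinearMap.BilinForm.posSemidef_of_apply {V ι : Type*} [AddCommGroup V] [Module ℝ V]
    [Fintype ι] {B : LinearMap.BilinForm ℝ V} (hsymm : ∀ v w, B v w = B w v)
    (hB : ∀ v, 0 ≤ B v v) (f : ι → V) :
    (Matrix.of fun i j ↦ B (f i) (f j)).PosSemidef := by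
  refine .of_dotProduct_mulVec_nonneg (Matrix.IsHermitian.ext fun i j ↦ hsymm _ _) fun x ↦ ?_
  rw [star_trivial, dotProduct_mulVec_of_apply]
  exact hB _

section GaussianMeasure

variable {W : Type*} [NormedAddCommGroup W] [NormedSpace ℝ W] [MeasurableSpace W] [BorelSpace W]

/-- The finite-dimensional marginals of a centered Gaussian measure. -/
theorem map_toLp_eq_multivariateGaussian {ν : Measure W} [IsProbabilityMeasure ν]
    {B : LinearMap.BilinForm ℝ (W →L[ℝ] ℝ)} (hsymm : ∀ f g, B f g = B g f)
    (hB : ∀ f, 0 ≤ B f f)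
    (hchar : ∀ f : W →L[ℝ] ℝ,
      (∫ w, Complex.exp (Complex.I * (f w : ℂ)) ∂ν) = Complex.exp (-(B f f : ℂ) / 2))
    {ι : Type*} [Fintype ι] [DecidableEq ι] (f : ι → W →L[ℝ] ℝ) :
    ν.map (fun w ↦ WithLp.toLp 2 fun i ↦ f i w) =
      multivariateGaussian 0 (Matrix.of fun i j ↦ B (f i) (f j)) := by
  have hm : Measurable fun w ↦ WithLp.toLp 2 fun i ↦ f i w := by fun_prop
  have := Measure.isProbabilityMeasure_map (μ := ν) hm.aemeasurable
  refine Measure.ext_of_charFun (funext fun t ↦ ?_)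
  rw [charFun_multivariateGaussian (LinearMap.BilinForm.posSemidef_of_apply hsymm hB f),
    LinearMap.BilinForm.dotProduct_mulVec_of_apply, charFun_apply,
    integral_map hm.aemeasurable (by fun_prop)]
  have h := hchar (∑ i, t i • f i)
  rw [inner_zero_right, Complex.ofReal_zero, zero_mul, zero_sub, ← neg_div, ← h]
  refine integral_congr_ae (ae_of_all _ fun w ↦ ?_)
  simp [PiLp.inner_apply, mul_comm]

theorem exists_seq_forall_norm_le_iff (W : Type*) [NormedAddCommGroup W] [NormedSpace ℝ W]
    [TopologicalSpace.SeparableSpace W] :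
    ∃ f : ℕ → W →L[ℝ] ℝ, ∀ (w : W) (r : ℝ), ‖w‖ ≤ r ↔ ∀ n, |f n w| ≤ r := by
  choose φ hφ₁ hφ₂ using fun w : W ↦ exists_dual_vector'' ℝ w
  refine ⟨fun n ↦ φ (TopologicalSpace.denseSeq W n), fun w r ↦ ⟨fun h n ↦ ?_, fun h ↦ ?_⟩⟩
  · exact ((φ _).le_of_opNorm_le (hφ₁ _) w).trans (by simpa using h)
  · refine le_of_forall_pos_le_add fun ε hε ↦ ?_
    obtain ⟨n, hn⟩ := (TopologicalSpace.denseRange_denseSeq W).exists_dist_lt w (half_pos hε)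
    set d := TopologicalSpace.denseSeq W n
    rw [dist_eq_norm] at hn
    have h₁ : φ d (d - w) ≤ ‖w - d‖ := by
      rw [norm_sub_rev]
      exact (le_abs_self _).trans (by simpa using (φ d).le_of_opNorm_le (hφ₁ d) (d - w))
    rw [map_sub, hφ₂ d] at h₁
    have h₂ : ‖w‖ ≤ ‖d‖ + ‖w - d‖ := by simpa using norm_add_le d (w - d)
    have h₃ := (le_abs_self _).trans (h n)
    simp only [RCLike.ofReal_real_eq_id, id_eq] at h₁
    linarith

/-- Centered balls have smaller measure under the centered Gaussian measure with larger
covariance. -/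
theorem measure_norm_le_le_of_covariance_le [TopologicalSpace.SeparableSpace W]
    {ν μ : Measure W} [IsProbabilityMeasure ν] [IsProbabilityMeasure μ]
    {Bν Bμ : LinearMap.BilinForm ℝ (W →L[ℝ] ℝ)}
    (hν_symm : ∀ f g, Bν f g = Bν g f) (hμ_symm : ∀ f g, Bμ f g = Bμ g f)
    (hν : ∀ f, 0 ≤ Bν f f) (hle : ∀ f, Bν f f ≤ Bμ f f)
    (hcharν : ∀ f : W →L[ℝ] ℝ,
      (∫ w, Complex.exp (Complex.I * (f w : ℂ)) ∂ν) = Complex.exp (-(Bν f f : ℂ) / 2))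
    (hcharμ : ∀ f : W →L[ℝ] ℝ,
      (∫ w, Complex.exp (Complex.I * (f w : ℂ)) ∂μ) = Complex.exp (-(Bμ f f : ℂ) / 2))
    (r : ℝ) : μ {w | ‖w‖ ≤ r} ≤ ν {w | ‖w‖ ≤ r} := by
  obtain ⟨f, hf⟩ := exists_seq_forall_norm_le_iff W
  let s (n : ℕ) : Set W := {w | ∀ i : Fin n, |f i w| ≤ r}
  have hs (n : ℕ) : MeasurableSet (s n) := by
    simp only [s, ofPred_forall]
    exact .iInter fun i ↦ measurableSet_le (by fun_prop) measurable_const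
  have hanti : Antitone s := fun m n hmn w hw i ↦ hw (Fin.castLE hmn i)
  have hball : {w : W | ‖w‖ ≤ r} = ⋂ n, s n := by
    ext w
    simp only [mem_ofPred_eq, hf, mem_iInter, s]
    exact ⟨fun h n i ↦ h i, fun h n ↦ h (n + 1) (Fin.last n)⟩
  rw [hball]
  refine le_of_tendsto_of_tendsto'
    (tendsto_measure_iInter_atTop (fun n ↦ (hs n).nullMeasurableSet) hanti ⟨0, by finiteness⟩)
    (tendsto_measure_iInter_atTop (fun n ↦ (hs n).nullMeasurableSet) hanti ⟨0, by finiteness⟩)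
    fun n ↦ ?_
  let C : Set (EuclideanSpace ℝ (Fin n)) := {x | ∀ i, |x i| ≤ r}
  have hC : MeasurableSet C := by
    simp only [C, ofPred_forall]
    exact .iInter fun i ↦ measurableSet_le (by fun_prop) measurable_const
  have hconv : Convex ℝ C := by
    intro x hx y hy a b ha hb hab i
    calc |(a • x + b • y) i| ≤ |a * x i| + |b * y i| := abs_add_le _ _
      _ ≤ a * r + b * r := by
        rw [abs_mul, abs_mul, abs_of_nonneg ha, abs_of_nonneg hb]
        gcongr
        exacts [hx i, hy i]
      _ = r := by rw [← add_mul, hab, one_mul]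
  have hsymm : ∀ x ∈ C, -x ∈ C := fun x hx i ↦ by simpa using hx i
  let g (i : Fin n) := f i
  have hm : Measurable fun w ↦ WithLp.toLp 2 fun i ↦ g i w := by fun_prop
  have hs_eq (ρ : Measure W) : ρ (s n) = ρ.map (fun w ↦ WithLp.toLp 2 fun i ↦ g i w) C :=
    (Measure.map_apply hm hC).symm
  simp only [Function.comp_apply]
  rw [hs_eq ν, hs_eq μ, map_toLp_eq_multivariateGaussian hν_symm hν hcharν,
    map_toLp_eq_multivariateGaussian hμ_symm (fun f ↦ (hν f).trans (hle f)) hcharμ]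
  refine multivariateGaussian_apply_le (LinearMap.BilinForm.posSemidef_of_apply hν_symm hν g) ?_
    hC hconv hsymm
  exact LinearMap.BilinForm.posSemidef_of_apply (B := Bμ - Bν)
    (fun f g ↦ by simp [hν_symm f g, hμ_symm f g]) (fun f ↦ by simpa using hle f) g

end GaussianMeasure

theorem lintegral_comp_norm_le_of_measure_norm_le {W : Type*} [NormedAddCommGroup W]
    [MeasurableSpace W] [BorelSpace W] {ν μ : Measure W} [IsProbabilityMeasure ν]
    [IsProbabilityMeasure μ] (h : ∀ r : ℝ, μ {w | ‖w‖ ≤ r} ≤ ν {w | ‖w‖ ≤ r}) {g : ℝ → ℝ}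
    (hg : ContinuousOn g (Ici 0)) (hg_mono : MonotoneOn g (Ici 0))
    (hg_nonneg : ∀ t : ℝ, 0 ≤ t → 0 ≤ g t) :
    (∫⁻ w, ENNReal.ofReal (g ‖w‖) ∂ν) ≤ ∫⁻ w, ENNReal.ofReal (g ‖w‖) ∂μ := by
  have hcont : Continuous fun w : W ↦ g ‖w‖ :=
    hg.comp_continuous continuous_norm fun w ↦ norm_nonneg w
  have hnn (w : W) : 0 ≤ g ‖w‖ := hg_nonneg _ (norm_nonneg w)
  rw [lintegral_eq_lintegral_meas_lt _ (ae_of_all _ hnn) hcont.measurable.aemeasurable,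
    lintegral_eq_lintegral_meas_lt _ (ae_of_all _ hnn) hcont.measurable.aemeasurable]
  refine lintegral_mono fun t ↦ ?_
  let S : Set ℝ := Ici 0 ∩ g ⁻¹' Iic t
  have hS : IsClosed S := hg.preimage_isClosed_of_isClosed isClosed_Ici isClosed_Iic
  rcases S.eq_empty_or_nonempty with hS₀ | hS₀
  · have huniv : {w : W | t < g ‖w‖} = univ := eq_univ_of_forall fun w ↦ by
      by_contra hw
      exact hS₀.le ⟨norm_nonneg w, by simpa using hw⟩
    simp [huniv]
  by_cases hbdd : BddAbove S
  · have hr := hS.csSup_mem hS₀ hbdd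
    have hcompl : {w : W | t < g ‖w‖} = {w | ‖w‖ ≤ sSup S}ᶜ := by
      ext w
      simp only [mem_ofPred_eq, mem_compl_iff, not_le]
      refine ⟨fun hw ↦ ?_, fun hw ↦ ?_⟩
      · by_contra! hle
        exact ((hg_mono (norm_nonneg w) hr.1 hle).trans hr.2).not_gt hw
      · by_contra! hle
        exact hw.not_ge (le_csSup hbdd ⟨norm_nonneg w, hle⟩)
    have hmeas : MeasurableSet {w : W | ‖w‖ ≤ sSup S} :=
      measurableSet_le measurable_norm measurable_const
    simp only [hcompl]
    rw [prob_compl_eq_one_sub hmeas, prob_compl_eq_one_sub hmeas]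
    exact tsub_le_tsub_left (h _) _
  · have hempty : {w : W | t < g ‖w‖} = ∅ := eq_empty_of_forall_notMem fun w hw ↦ by
      obtain ⟨r, hr, hwr⟩ := not_bddAbove_iff.1 hbdd ‖w‖
      exact ((hg_mono (norm_nonneg w) hr.1 hwr.le).trans hr.2).not_gt hw
    simp [hempty]

end

/-- Gaussian comparison: if `ν` and `μ` are centered Gaussian measures on a real separable
Banach space `W` with covariances satisfying `q_ν(f,f) ≤ q_μ(f,f)` for all `f ∈ W*`, then
for every nonnegative nondecreasing `C¹` function `g : [0,∞) → [0,∞)`: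
`∫_W g(‖w‖) dν(w) ≤ ∫_W g(‖w‖) dμ(w)`. -/
theorem gaussian_comparison
    {W : Type*} [NormedAddCommGroup W] [NormedSpace ℝ W]
    [TopologicalSpace.SeparableSpace W] [MeasurableSpace W] [BorelSpace W]
    (ν μ : Measure W) [IsProbabilityMeasure ν] [IsProbabilityMeasure μ]
    (qν qμ : (W →L[ℝ] ℝ) → (W →L[ℝ] ℝ) → ℝ)
    (hqν_symm : ∀ f g : W →L[ℝ] ℝ, qν f g = qν g f)
    (hqν_add : ∀ f g h : W →L[ℝ] ℝ, qν (f + g) h = qν f h + qν g h)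
    (hqν_smul : ∀ (r : ℝ) (f g : W →L[ℝ] ℝ), qν (r • f) g = r * qν f g)
    (hqν_nonneg : ∀ f : W →L[ℝ] ℝ, 0 ≤ qν f f)
    (hqμ_symm : ∀ f g : W →L[ℝ] ℝ, qμ f g = qμ g f)
    (hqμ_add : ∀ f g h : W →L[ℝ] ℝ, qμ (f + g) h = qμ f h + qμ g h)
    (hqμ_smul : ∀ (r : ℝ) (f g : W →L[ℝ] ℝ), qμ (r • f) g = r * qμ f g)
    (hqμ_nonneg : ∀ f : W →L[ℝ] ℝ, 0 ≤ qμ f f)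
    (hcharν : ∀ f : W →L[ℝ] ℝ,
      (∫ w, Complex.exp (Complex.I * (f w : ℂ)) ∂ν) = Complex.exp (-(qν f f : ℂ) / 2))
    (hcharμ : ∀ f : W →L[ℝ] ℝ,
      (∫ w, Complex.exp (Complex.I * (f w : ℂ)) ∂μ) = Complex.exp (-(qμ f f : ℂ) / 2))
    (hle : ∀ f : W →L[ℝ] ℝ, qν f f ≤ qμ f f)
    (g : ℝ → ℝ)
    (hg_smooth : ContDiffOn ℝ 1 g (Set.Ici (0:ℝ)))
    (hg_mono : MonotoneOn g (Set.Ici (0:ℝ)))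
    (hg_nonneg : ∀ t : ℝ, 0 ≤ t → 0 ≤ g t) :
    (∫⁻ w, ENNReal.ofReal (g ‖w‖) ∂ν) ≤ ∫⁻ w, ENNReal.ofReal (g ‖w‖) ∂μ := by
  let B (q : (W →L[ℝ] ℝ) → (W →L[ℝ] ℝ) → ℝ) (hsymm : ∀ f g : W →L[ℝ] ℝ, q f g = q g f)
      (hadd : ∀ f g h : W →L[ℝ] ℝ, q (f + g) h = q f h + q g h)
      (hsmul : ∀ (r : ℝ) (f g : W →L[ℝ] ℝ), q (r • f) g = r * q f g) :
      LinearMap.BilinForm ℝ (W →L[ℝ] ℝ) :=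
    LinearMap.mk₂ ℝ q hadd hsmul
      (fun f g h ↦ by rw [hsymm, hadd, hsymm g, hsymm h])
      (fun r f g ↦ by rw [hsymm, hsmul, hsymm g, smul_eq_mul])
  exact lintegral_comp_norm_le_of_measure_norm_le
    (measure_norm_le_le_of_covariance_le (Bν := B qν hqν_symm hqν_add hqν_smul)
      (Bμ := B qμ hqμ_symm hqμ_add hqμ_smul) hqν_symm hqμ_symm hqν_nonneg hle hcharν hcharμ)
    hg_smooth.continuousOn hg_mono hg_nonneg
end
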